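/- arXiv:math/9407208 — 2 statements merged into one kernel-verified Lean document; each statement's English description precedes it below -/
import Mathlib

section
/- If the Cantor space 2^ω is partitioned into κ nonempty pairwise disjoint null sets ⟨X_α : α < κ⟩ (κ an uncountable cardinal) such that every null subset of 2^ω is contained in the union of countably many of the X_α, then κ = ω₁. -/
open Cardinal Set MeasureTheory

/-- `μ` is the uniform product measure on the Cantor space `2^ω = ℕ → 2`: each basic
cylinder determined by the first `n` coordinates has measure `(1/2)^n`. (This property
determines `μ` uniquely on the Borel = product σ-algebra.) -/
def IsCantorMeasure (μ : Measure (ℕ → Bool)) : Prop :=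
  ∀ (n : ℕ) (s : ℕ → Bool), μ {f | ∀ i < n, f i = s i} = (1 / 2 : ENNReal) ^ n

namespace IsCantorMeasure

variable {μ ν : Measure (ℕ → Bool)}

theorem isProbabilityMeasure (hμ : IsCantorMeasure μ) : IsProbabilityMeasure μ :=
  ⟨by simpa using hμ 0 fun _ ↦ false⟩

theorem measure_singleton (hμ : IsCantorMeasure μ) (y : ℕ → Bool) : μ {y} = 0 := by
  have h : ∀ n : ℕ, μ {y} ≤ (1 / 2 : ENNReal) ^ n := fun n ↦ by
    rw [← hμ n y]
    exact measure_mono (by simp)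
  exact le_antisymm (ge_of_tendsto'
    (ENNReal.tendsto_pow_atTop_nhds_zero_of_lt_one (by simp)) h) zero_le

theorem isPiSystem_cylinders :
    IsPiSystem {s | ∃ (x : ℕ → Bool) (n : ℕ), s = PiNat.cylinder x n} := by
  rintro _ ⟨x, m, rfl⟩ _ ⟨y, n, rfl⟩ ⟨z, hx, hy⟩
  refine ⟨z, max m n, ?_⟩
  rw [← PiNat.mem_cylinder_iff_eq.1 hx, ← PiNat.mem_cylinder_iff_eq.1 hy]
  ext w
  simp only [mem_inter_iff, PiNat.mem_cylinder_iff, lt_max_iff]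
  grind

theorem eq (hμ : IsCantorMeasure μ) (hν : IsCantorMeasure ν) : μ = ν := by
  have := hμ.isProbabilityMeasure
  refine ext_of_generate_finite _ ?_ isPiSystem_cylinders ?_ ?_
  · rw [BorelSpace.measurable_eq (α := ℕ → Bool)]
    exact (PiNat.isTopologicalBasis_cylinders fun _ ↦ Bool).borel_eq_generateFrom
  · rintro _ ⟨x, n, rfl⟩
    exact (hμ n x).trans (hν n x).symm
  · simpa using (hμ 0 fun _ ↦ false).trans (hν 0 fun _ ↦ false).symm

end IsCantorMeasure

/-- The sequence with even coordinates `x` and odd coordinates `y`. -/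
def interleave (x y : ℕ → Bool) (n : ℕ) : Bool :=
  if n % 2 = 0 then x (n / 2) else y (n / 2)

theorem interleave_even (x y : ℕ → Bool) (n : ℕ) : interleave x y (2 * n) = x n := by
  simp [interleave]

theorem interleave_odd (x y : ℕ → Bool) (n : ℕ) : interleave x y (2 * n + 1) = y n := by
  have h₁ : (2 * n + 1) % 2 = 1 := by lia
  have h₂ : (2 * n + 1) / 2 = n := by lia
  simp [interleave, h₁, h₂]

theorem measurable_interleave :
    Measurable fun p : (ℕ → Bool) × (ℕ → Bool) ↦ interleave p.1 p.2 := by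
  refine measurable_pi_lambda _ fun n ↦ ?_
  unfold interleave
  split_ifs <;> fun_prop

theorem preimage_interleave_cylinder (s : ℕ → Bool) (n : ℕ) :
    (fun p : (ℕ → Bool) × (ℕ → Bool) ↦ interleave p.1 p.2) ⁻¹' {f | ∀ i < n, f i = s i} =
      {f | ∀ i < (n + 1) / 2, f i = s (2 * i)} ×ˢ {f | ∀ i < n / 2, f i = s (2 * i + 1)} := by
  ext ⟨x, y⟩
  simp only [mem_preimage, mem_ofPred_eq, mem_prod]
  constructor
  · intro h
    refine ⟨fun i hi ↦ ?_, fun i hi ↦ ?_⟩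
    · rw [← h _ (by lia), interleave_even]
    · rw [← h _ (by lia), interleave_odd]
  · rintro ⟨hx, hy⟩ i hi
    obtain ⟨k, rfl | rfl⟩ := Nat.even_or_odd' i
    · rw [interleave_even, hx k (by lia)]
    · rw [interleave_odd, hy k (by lia)]

namespace IsCantorMeasure

variable {μ : Measure (ℕ → Bool)}

theorem map_interleave (hμ : IsCantorMeasure μ) :
    (μ.prod μ).map (fun p ↦ interleave p.1 p.2) = μ := by
  have := hμ.isProbabilityMeasure
  refine IsCantorMeasure.eq (fun n s ↦ ?_) hμ
  have hs : MeasurableSet {f : ℕ → Bool | ∀ i < n, f i = s i} :=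
    (PiNat.isOpen_cylinder (fun _ ↦ Bool) s n).measurableSet
  rw [Measure.map_apply measurable_interleave hs, preimage_interleave_cylinder, Measure.prod_prod,
    hμ _ fun i ↦ s (2 * i), hμ _ fun i ↦ s (2 * i + 1), ← pow_add]
  congr 1
  lia

theorem ae_measure_section_eq_zero (hμ : IsCantorMeasure μ) {N : Set (ℕ → Bool)} (hN : μ N = 0) :
    μ {x | μ {y | interleave x y ∈ N} ≠ 0} = 0 := by
  have := hμ.isProbabilityMeasure
  have h : ∀ᵐ z ∂(μ.prod μ).map (fun p ↦ interleave p.1 p.2), z ∉ N := by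
    rw [hμ.map_interleave]
    exact measure_eq_zero_iff_ae_notMem.1 hN
  have h' := Measure.ae_ae_of_ae_prod (ae_of_ae_map measurable_interleave.aemeasurable h)
  exact ae_iff.1 (h'.mono fun x hx ↦ measure_eq_zero_iff_ae_notMem.2 hx)

theorem measure_range_interleave_right (hμ : IsCantorMeasure μ) (x : ℕ → Bool) :
    μ (range fun y ↦ interleave x y) = 0 := by
  have := hμ.isProbabilityMeasure
  have hm : Measurable fun (f : ℕ → Bool) n ↦ f (2 * n) := by fun_prop
  refine measure_mono_null (t := (fun (f : ℕ → Bool) n ↦ f (2 * n)) ⁻¹' ({x} : Set (ℕ → Bool))) ?_ ?_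
  · rintro _ ⟨y, rfl⟩
    exact funext fun n ↦ interleave_even x y n
  · have h : (fun p : (ℕ → Bool) × (ℕ → Bool) ↦ interleave p.1 p.2) ⁻¹'
        ((fun (f : ℕ → Bool) n ↦ f (2 * n)) ⁻¹' {x}) = {x} ×ˢ Set.univ := by
      ext p
      simp [interleave_even]
    rw [← hμ.map_interleave,
      Measure.map_apply measurable_interleave (hm (measurableSet_singleton x)),
      h, Measure.prod_prod, hμ.measure_singleton, zero_mul]

theorem measure_range_interleave_left (hμ : IsCantorMeasure μ) (y : ℕ → Bool) :
    μ (range fun x ↦ interleave x y) = 0 := by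
  have := hμ.isProbabilityMeasure
  have hm : Measurable fun (f : ℕ → Bool) n ↦ f (2 * n + 1) := by fun_prop
  refine measure_mono_null (t := (fun (f : ℕ → Bool) n ↦ f (2 * n + 1)) ⁻¹' ({y} : Set (ℕ → Bool))) ?_ ?_
  · rintro _ ⟨x, rfl⟩
    exact funext fun n ↦ interleave_odd x y n
  · have h : (fun p : (ℕ → Bool) × (ℕ → Bool) ↦ interleave p.1 p.2) ⁻¹'
        ((fun (f : ℕ → Bool) n ↦ f (2 * n + 1)) ⁻¹' {y}) = Set.univ ×ˢ {y} := by
      ext p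
      simp [interleave_odd]
    rw [← hμ.map_interleave,
      Measure.map_apply measurable_interleave (hm (measurableSet_singleton y)),
      h, Measure.prod_prod, hμ.measure_singleton, mul_zero]

end IsCantorMeasure

theorem mk_iUnion_le_aleph_one {α β : Type} {f : α → Set β} (hα : #α ≤ ℵ₁)
    (hf : ∀ a, (f a).Countable) : #(⋃ a, f a) ≤ ℵ₁ :=
  calc #(⋃ a, f a) ≤ #α * ⨆ a, #(f a) := mk_iUnion_le f
    _ ≤ ℵ₁ * ℵ₁ := mul_le_mul' hα <| ciSup_le' fun a ↦
        (le_aleph0_iff_set_countable.2 (hf a)).trans (aleph0_le_aleph 1)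
    _ = ℵ₁ := mul_eq_self (aleph0_le_aleph 1)

/-- A surjective labelling of the Cantor space with null fibres, under which null sets carry
countably many labels, has at most `ℵ₁` labels. -/
theorem IsCantorMeasure.mk_le_aleph_one {μ : Measure (ℕ → Bool)} (hμ : IsCantorMeasure μ)
    {ι : Type} {c : (ℕ → Bool) → ι} (hc : Function.Surjective c)
    (hnull : ∀ i, μ (c ⁻¹' {i}) = 0) (hcof : ∀ Y, μ Y = 0 → (c '' Y).Countable) : #ι ≤ ℵ₁ := by
  by_contra! hlt
  obtain ⟨p, hp⟩ := hc.hasRightInverse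
  obtain ⟨T, hT⟩ := le_mk_iff_exists_set.1 hlt.le
  have hpT : μ (p '' T) ≠ 0 := fun h ↦ by
    have h' := hcof _ h
    rw [image_image, image_congr fun i _ ↦ hp i, image_id', ← le_aleph0_iff_set_countable, hT] at h'
    exact h'.not_gt aleph0_lt_aleph_one
  let U : Set ι := ⋃ t : T, c '' range fun x ↦ interleave x (p t)
  have hU : #U ≤ ℵ₁ := mk_iUnion_le_aleph_one hT.le fun t ↦
    hcof _ (hμ.measure_range_interleave_left _)
  let V : Set ι := ⋃ u : U, c '' {x | μ {y | interleave x y ∈ c ⁻¹' {u.1}} ≠ 0}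
  have hV : #V ≤ ℵ₁ := mk_iUnion_le_aleph_one hU fun u ↦
    hcof _ (hμ.ae_measure_section_eq_zero (hnull u))
  obtain ⟨i, hi⟩ : ∃ i, i ∉ V := by
    by_contra! h
    rw [eq_univ_of_forall h, mk_univ] at hV
    exact hV.not_gt hlt
  have hsection : ∀ u ∈ U, μ {y | interleave (p i) y ∈ c ⁻¹' {u}} = 0 := fun u hu ↦ by
    by_contra h
    exact hi (mem_iUnion.2 ⟨⟨u, hu⟩, p i, h, hp i⟩)
  have hW := (hcof _ (hμ.measure_range_interleave_right (p i))).mono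
    (inter_subset_left (t := U))
  refine hpT (measure_mono_null ?_ ((measure_biUnion_null_iff hW).2 fun u hu ↦ hsection u hu.2))
  rintro _ ⟨t, ht, rfl⟩
  refine mem_biUnion (x := c (interleave (p i) (p t))) ⟨⟨_, ⟨p t, rfl⟩, rfl⟩, ?_⟩ rfl
  exact mem_iUnion.2 ⟨⟨t, ht⟩, _, ⟨p i, rfl⟩, rfl⟩

/-- If the Cantor space `2^ω` is partitioned into `κ` nonempty pairwise disjoint null
sets (`κ` an uncountable cardinal) such that every null set is contained in the union
of countably many of the pieces, then `κ = ω₁`. -/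
theorem partition_null_kappa_eq_aleph_one (μ : Measure (ℕ → Bool)) (hμ : IsCantorMeasure μ)
    (κ : Cardinal.{0}) (hκ : Cardinal.aleph0 < κ)
    (ι : Type) (hι : #ι = κ) (Xs : ι → Set (ℕ → Bool))
    (hnull : ∀ i, μ (Xs i) = 0)
    (hne : ∀ i, (Xs i).Nonempty)
    (hdisj : ∀ i j, i ≠ j → Disjoint (Xs i) (Xs j))
    (hcover : (⋃ i, Xs i) = Set.univ)
    (hcof : ∀ Y : Set (ℕ → Bool), μ Y = 0 →
      ∃ Δ : Set ι, Δ.Countable ∧ Y ⊆ ⋃ i ∈ Δ, Xs i) :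
    κ = Cardinal.aleph 1 := by
  subst hι
  refine le_antisymm ?_ (by rwa [← succ_aleph0, Order.succ_le_iff])
  have hex : ∀ x, ∃ i, x ∈ Xs i := fun x ↦ mem_iUnion.1 (hcover ▸ mem_univ x)
  choose c hc using hex
  have huniq : ∀ {x i}, x ∈ Xs i → c x = i := fun {x i} hx ↦ by
    by_contra h
    exact disjoint_left.1 (hdisj _ _ h) (hc x) hx
  refine hμ.mk_le_aleph_one (c := c) (fun i ↦ (hne i).imp fun x hx ↦ huniq hx)
    (fun i ↦ measure_mono_null (fun x hx ↦ ?_) (hnull i)) fun Y hY ↦ ?_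
  · rw [← show c x = i from hx]
    exact hc x
  · obtain ⟨Δ, hΔ, hYΔ⟩ := hcof Y hY
    refine hΔ.mono ?_
    rintro _ ⟨y, hy, rfl⟩
    obtain ⟨i, hi, hyi⟩ := mem_iUnion₂.1 (hYΔ hy)
    rwa [huniq hyi]
end

section
/- Let κ be a regular uncountable cardinal. The meager ideal M on the Cantor space 2^ω is (κ,λ)-nicely generated for some cardinal λ with κ ≤ λ ≤ 2^{ℵ₀} if and only if add(M) = cof(M) = κ. -/
open Cardinal Set

/-- An ideal `I` on a set `X` is `(κ, λ)`-nicely generated if there is a partition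
`⟨X_α : α < λ⟩` of `X` into nonempty sets belonging to `I` such that (i) the union of any
fewer than `κ` pieces belongs to `I`, and (ii) every member of `I` is contained in the
union of fewer than `κ` pieces. -/
def NicelyGenerated {X : Type u} (I : Set (Set X)) (κ lam : Cardinal.{u}) : Prop :=
  ∃ (ι : Type u) (Xs : ι → Set X),
    #ι = lam ∧
    (∀ i, Xs i ∈ I) ∧
    (∀ i, (Xs i).Nonempty) ∧
    (∀ i j, i ≠ j → Disjoint (Xs i) (Xs j)) ∧
    (⋃ i, Xs i) = Set.univ ∧
    (∀ Δ : Set ι, #Δ < κ → (⋃ i ∈ Δ, Xs i) ∈ I) ∧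
    (∀ Y ∈ I, ∃ Δ : Set ι, #Δ < κ ∧ Y ⊆ ⋃ i ∈ Δ, Xs i)

/-- The additivity of an ideal `I`: the least cardinality of a subfamily of `I` whose
union is not in `I`. -/
noncomputable def addIdeal {X : Type u} (I : Set (Set X)) : Cardinal.{u} :=
  sInf {c | ∃ F : Set (Set X), F ⊆ I ∧ ⋃₀ F ∉ I ∧ #F = c}

/-- The cofinality of an ideal `I`: the least cardinality of a subfamily of `I` that is
cofinal in `I` with respect to inclusion. -/
noncomputable def cofIdeal {X : Type u} (I : Set (Set X)) : Cardinal.{u} :=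
  sInf {c | ∃ F : Set (Set X), F ⊆ I ∧ (∀ Y ∈ I, ∃ Z ∈ F, Y ⊆ Z) ∧ #F = c}

theorem addIdeal_le_mk {X : Type u} {I F : Set (Set X)} (hF : F ⊆ I) (hU : ⋃₀ F ∉ I) :
    addIdeal I ≤ #F :=
  csInf_le' (Set.mem_ofPred_eq ▸ ⟨F, hF, hU, rfl⟩)

theorem cofIdeal_le_mk {X : Type u} {I F : Set (Set X)} (hF : F ⊆ I)
    (hcof : ∀ Y ∈ I, ∃ Z ∈ F, Y ⊆ Z) : cofIdeal I ≤ #F :=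
  csInf_le' (Set.mem_ofPred_eq ▸ ⟨F, hF, hcof, rfl⟩)

theorem NicelyGenerated.iUnion_mem {X : Type u} {I : Set (Set X)} {κ lam : Cardinal.{u}}
    (h : NicelyGenerated I κ lam) (hI : ∀ s t, s ⊆ t → t ∈ I → s ∈ I) (hκ : κ.IsRegular)
    {J : Type u} (hJ : #J < κ) {Y : J → Set X} (hY : ∀ j, Y j ∈ I) : (⋃ j, Y j) ∈ I := by
  obtain ⟨ι, Xs, -, -, -, -, -, hsmall, hcov⟩ := h
  choose D hD hYD using fun j ↦ hcov (Y j) (hY j)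
  refine hI _ _ (iUnion_subset fun j x hx ↦ ?_)
    (hsmall (⋃ j, D j) ((card_iUnion_lt_iff_forall_of_isRegular hκ hJ).2 hD))
  obtain ⟨i, hi, hxi⟩ := mem_iUnion₂.1 (hYD j hx)
  exact mem_iUnion₂.2 ⟨i, mem_iUnion.2 ⟨j, hi⟩, hxi⟩

theorem subset_of_biUnion_subset_biUnion {X ι : Type u} {Xs : ι → Set X}
    (hne : ∀ i, (Xs i).Nonempty)
    (hdisj : ∀ i j, i ≠ j → Disjoint (Xs i) (Xs j)) {S T : Set ι}
    (h : (⋃ i ∈ S, Xs i) ⊆ ⋃ i ∈ T, Xs i) : S ⊆ T := by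
  intro i hi
  obtain ⟨x, hx⟩ := hne i
  obtain ⟨j, hj, hxj⟩ := mem_iUnion₂.1 (h (mem_iUnion₂.2 ⟨i, hi, hx⟩))
  by_cases hij : i = j
  · exact hij ▸ hj
  · exact absurd hxj ((hdisj i j hij).notMem_of_mem_left hx)

theorem NicelyGenerated.addIdeal_eq {X : Type u} {I : Set (Set X)} {κ lam : Cardinal.{u}}
    (h : NicelyGenerated I κ lam) (hI : ∀ s t, s ⊆ t → t ∈ I → s ∈ I) (hκ : κ.IsRegular)
    (hle : κ ≤ lam) : addIdeal I = κ := by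
  have hU := fun (F : Set (Set X)) (hF : F ⊆ I) (hc : #F < κ) ↦
    h.iUnion_mem hI hκ hc (Y := fun s : F ↦ s.1) fun s ↦ hF s.2
  obtain ⟨ι, Xs, hι, hmem, hne, hdisj, -, -, hcov⟩ := h
  obtain ⟨S, hS⟩ := le_mk_iff_exists_set.1 (hι ▸ hle)
  have hnot : ⋃₀ (Xs '' S) ∉ I := fun hmemU ↦ by
    obtain ⟨T, hT, hST⟩ := hcov _ hmemU
    rw [sUnion_image] at hST
    exact (hS ▸ mk_le_mk_of_subset (subset_of_biUnion_subset_biUnion hne hdisj hST)).not_gt hT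
  have hF : Xs '' S ⊆ I := image_subset_iff.2 fun i _ ↦ hmem i
  apply le_antisymm
  · exact (addIdeal_le_mk hF hnot).trans (mk_image_le.trans hS.le)
  · refine le_csInf ⟨_, _, hF, hnot, rfl⟩ ?_
    rintro c ⟨F, hFI, hFU, rfl⟩
    by_contra! hlt
    exact hFU (sUnion_eq_iUnion ▸ hU F hFI hlt)

theorem addIdeal_le_cofIdeal {X : Type u} {I : Set (Set X)} (hU : ⋃₀ I = Set.univ)
    (huniv : Set.univ ∉ I) : addIdeal I ≤ cofIdeal I := by
  refine le_csInf ⟨_, I, Subset.rfl, fun Y hY ↦ ⟨Y, hY, Subset.rfl⟩, rfl⟩ ?_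
  rintro c ⟨F, hFI, hF, rfl⟩
  refine addIdeal_le_mk hFI ?_
  suffices ⋃₀ F = Set.univ by rwa [this]
  refine eq_univ_of_forall fun x ↦ ?_
  obtain ⟨Y, hY, hx⟩ := mem_sUnion.1 (hU ▸ mem_univ x)
  obtain ⟨Z, hZ, hYZ⟩ := hF Y hY
  exact ⟨Z, hZ, hYZ hx⟩

theorem mk_Iic_toType_ord_lt {κ : Cardinal.{u}} (hκ : κ.IsRegular) (i : κ.ord.ToType) :
    #(Iic i) < κ := by
  rw [← Iio_insert]
  exact mk_insert_le.trans_lt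
    (add_lt_of_lt hκ.aleph0_le (mk_Iio_lt i (by simp) |>.trans_eq (by simp))
      (one_lt_aleph0.trans_le hκ.aleph0_le))

theorem exists_subset_Iic_toType_ord {κ : Cardinal.{u}} (hκ : κ.IsRegular)
    {D : Set κ.ord.ToType} (hD : #D < κ) : ∃ i, D ⊆ Iic i := by
  by_contra! h
  have hcov : (⋃ j ∈ D, Iic j) = Set.univ := eq_univ_of_forall fun i ↦ by
    obtain ⟨j, hj, hij⟩ := not_subset.1 (h i)
    exact mem_iUnion₂.2 ⟨j, hj, (not_le.1 (mt mem_Iic.2 hij)).le⟩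
  have := (card_biUnion_lt_iff_forall_of_isRegular hκ hD (t := fun j _ ↦ Iic j)).2
    fun j _ ↦ mk_Iic_toType_ord_lt hκ j
  rw [hcov] at this
  simp at this

theorem NicelyGenerated.cofIdeal_le {X : Type u} {I : Set (Set X)} {κ : Cardinal.{u}}
    (h : NicelyGenerated I κ κ) (hκ : κ.IsRegular) : cofIdeal I ≤ κ := by
  obtain ⟨ι, Xs, hι, -, -, -, -, hsmall, hcov⟩ := h
  obtain ⟨e⟩ : Nonempty (κ.ord.ToType ≃ ι) := Cardinal.eq.1 (by simp [hι])
  let Z : κ.ord.ToType → Set X := fun a ↦ ⋃ i ∈ e '' Iic a, Xs i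
  refine (cofIdeal_le_mk (F := range Z) ?_ fun Y hY ↦ ?_).trans (mk_range_le.trans (by simp))
  · rintro _ ⟨a, rfl⟩
    exact hsmall _ (mk_image_le.trans_lt (mk_Iic_toType_ord_lt hκ a))
  · obtain ⟨D, hD, hYD⟩ := hcov Y hY
    obtain ⟨a, ha⟩ := exists_subset_Iic_toType_ord hκ (D := e.symm '' D)
      (mk_image_le.trans_lt hD)
    refine ⟨Z a, mem_range_self a, hYD.trans (biUnion_subset_biUnion_left fun i hi ↦ ?_)⟩
    exact ⟨e.symm i, ha (mem_image_of_mem _ hi), e.apply_symm_apply i⟩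

theorem NicelyGenerated.exists_notMem_iUnion {X : Type u} {I : Set (Set X)}
    {κ lam : Cardinal.{u}} (h : NicelyGenerated I κ lam) (hκ : ℵ₀ ≤ κ) (hlt : κ < lam)
    {J : Type u} (hJ : #J ≤ κ) {Y : J → Set X} (hY : ∀ j, Y j ∈ I) : ∃ x, ∀ j, x ∉ Y j := by
  obtain ⟨ι, Xs, rfl, -, hne, hdisj, -, -, hcov⟩ := h
  choose D hD hYD using fun j ↦ hcov (Y j) (hY j)
  have hcard : #(⋃ j, D j) ≤ κ := (mk_iUnion_le D).trans <|
    (mul_le_mul' hJ (ciSup_le' fun j ↦ (hD j).le)).trans (mul_eq_self hκ).le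
  obtain ⟨i, hi⟩ : ∃ i, i ∉ ⋃ j, D j := by
    by_contra! hall
    rw [eq_univ_of_forall hall, mk_univ] at hcard
    exact hcard.not_gt hlt
  obtain ⟨x, hx⟩ := hne i
  refine ⟨x, fun j hj ↦ ?_⟩
  obtain ⟨k, hk, hxk⟩ := mem_iUnion₂.1 (hYD j hj)
  have hik : i ≠ k := fun hik ↦ hi (mem_iUnion.2 ⟨j, hik ▸ hk⟩)
  exact (hdisj i k hik).notMem_of_mem_left hx hxk

/-- One direction of the Kuratowski–Ulam theorem. -/
theorem IsMeagre.setOf_not_isMeagre_fiber {X Y : Type*} [TopologicalSpace X]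
    [TopologicalSpace Y] [SecondCountableTopology X] {P : Set (X × Y)} (hP : IsMeagre P) :
    IsMeagre {y | ¬ IsMeagre ((fun x ↦ (x, y)) ⁻¹' P)} := by
  obtain ⟨S, hSo, hSd, hSc, hSP⟩ := mem_residual_iff.1 hP
  let B := TopologicalSpace.countableBasis X
  have hB : B.Countable := TopologicalSpace.countable_countableBasis X
  let W : Set (X × Y) → Set X → Set Y := fun U V ↦ Prod.snd '' (U ∩ V ×ˢ Set.univ)
  have hW : ∀ U ∈ S, ∀ V ∈ B, W U V ∈ residual Y := fun U hU V hV ↦ by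
    have hVo : IsOpen V := TopologicalSpace.isOpen_of_mem_countableBasis hV
    refine residual_of_dense_open
      (isOpenMap_snd _ ((hSo U hU).inter (hVo.prod isOpen_univ))) ?_
    rw [dense_iff_inter_open]
    intro O hO hOne
    obtain ⟨⟨x, y⟩, hxy, hU'⟩ := (hSd U hU).inter_open_nonempty (V ×ˢ O) (hVo.prod hO)
      ((TopologicalSpace.nonempty_of_mem_countableBasis hV).prod hOne)
    exact ⟨y, hxy.2, (x, y), ⟨hU', hxy.1, mem_univ _⟩, rfl⟩
  have hall : (⋂ U ∈ S, ⋂ V ∈ B, W U V) ∈ residual Y :=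
    (countable_bInter_mem hSc).2 fun U hU ↦ (countable_bInter_mem hB).2 fun V hV ↦ hW U hU V hV
  refine Filter.mem_of_superset hall fun y hy ↦ ?_
  simp only [mem_iInter] at hy
  simp only [mem_compl_iff, mem_ofPred_eq, not_not]
  refine mem_residual_iff.2 ⟨(fun U ↦ (fun x ↦ (x, y)) ⁻¹' U) '' S, ?_, ?_, hSc.image _, ?_⟩
  · rintro _ ⟨U, hU, rfl⟩
    exact (hSo U hU).preimage (by fun_prop)
  · rintro _ ⟨U, hU, rfl⟩
    refine (TopologicalSpace.isBasis_countableBasis X).dense_iff.2 fun V hV _ ↦ ?_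
    obtain ⟨⟨x, y'⟩, ⟨hxU, hxV, -⟩, rfl⟩ := hy U hU V hV
    exact ⟨x, hxV, hxU⟩
  · intro x hx
    refine hSP fun U hU ↦ ?_
    exact hx _ (mem_image_of_mem _ hU)

/-- The Cantor space is homeomorphic to its square. -/
def cantorProdHomeomorph : (ℕ → Bool) × (ℕ → Bool) ≃ₜ (ℕ → Bool) :=
  Homeomorph.sumArrowHomeomorphProdArrow.symm.trans
    (Homeomorph.piCongrLeft (Y := fun _ ↦ Bool) Equiv.natSumNatEquivNat)

theorem isMeagre_singleton_cantor (x : ℕ → Bool) : IsMeagre ({x} : Set (ℕ → Bool)) := by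
  refine IsNowhereDense.isMeagre ?_
  rw [isClosed_singleton.isNowhereDense_iff, interior_eq_empty_iff_dense_compl]
  refine fun y ↦ ?_
  by_cases hy : y = x
  · subst hy
    refine mem_closure_of_tendsto (f := fun n ↦ Function.update y n (!y n)) (b := Filter.atTop)
      (tendsto_pi_nhds.2 fun k ↦ ?_) (Filter.Eventually.of_forall fun n h ↦ ?_)
    · refine tendsto_const_nhds.congr' ?_
      filter_upwards [Filter.eventually_gt_atTop k] with n hn
      simp [Function.update_of_ne hn.ne]
    · simpa using congrFun (mem_singleton_iff.1 h) n
  · exact subset_closure hy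

theorem not_isMeagre_univ_cantor : ¬ IsMeagre (Set.univ : Set (ℕ → Bool)) := by
  intro h
  obtain ⟨x, hx⟩ := (dense_of_mem_residual h).nonempty
  exact hx (mem_univ x)

/-- If the meager ideal on the Cantor space is nicely generated by more than `κ` pieces, compare
the pieces of the line with those of the plane: by Kuratowski–Ulam, the union of `κ` pieces would
be covered by fewer than `κ` meager horizontal sections. -/
theorem NicelyGenerated.le_of_meager {κ lam : Cardinal.{0}} (hκ : κ.IsRegular)
    (h : NicelyGenerated {s : Set (ℕ → Bool) | IsMeagre s} κ lam) : lam ≤ κ := by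
  by_contra! hlt
  have hmono : ∀ s t : Set (ℕ → Bool), s ⊆ t → t ∈ {s : Set (ℕ → Bool) | IsMeagre s} →
      s ∈ {s : Set (ℕ → Bool) | IsMeagre s} := fun s t hst ht ↦ ht.mono hst
  have havoid := fun {J : Type} (hJ : #J ≤ κ) {Y : J → Set (ℕ → Bool)} ↦
    h.exists_notMem_iUnion hκ.aleph0_le hlt hJ (Y := Y)
  have hadd := fun {J : Type} (hJ : #J < κ) {Y : J → Set (ℕ → Bool)} ↦
    h.iUnion_mem hmono hκ hJ (Y := Y)
  obtain ⟨ι, Xs, rfl, hmem, hne, hdisj, hun, -, hcov⟩ := h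
  let φ := cantorProdHomeomorph
  let P : ι → Set ((ℕ → Bool) × (ℕ → Bool)) := fun i ↦ φ ⁻¹' Xs i
  have hP : ∀ i, IsMeagre (P i) := fun i ↦
    IsMeagre.preimage_of_isOpenMap φ.continuous φ.isOpenMap (hmem i)
  have hplane : ∀ A : Set ((ℕ → Bool) × (ℕ → Bool)), IsMeagre A →
      ∃ D : Set ι, #D < κ ∧ ∀ z ∈ A, ∀ i, z ∈ P i → i ∈ D := by
    intro A hA
    obtain ⟨D, hD, hAD⟩ := hcov (φ.symm ⁻¹' A)
      (IsMeagre.preimage_of_isOpenMap φ.symm.continuous φ.symm.isOpenMap hA)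
    refine ⟨D, hD, fun z hz i hi ↦ ?_⟩
    obtain ⟨j, hj, hzj⟩ := mem_iUnion₂.1 (hAD (show φ z ∈ φ.symm ⁻¹' A by simpa using hz))
    by_cases hij : i = j
    · exact hij ▸ hj
    · exact absurd hzj ((hdisj i j hij).notMem_of_mem_left hi)
  choose D hD hDmem using fun i ↦ hplane (Prod.fst ⁻¹' Xs i)
    (IsMeagre.preimage_of_isOpenMap continuous_fst isOpenMap_fst (hmem i))
  obtain ⟨S, hS⟩ := le_mk_iff_exists_set.1 hlt.le
  let T : Set ι := ⋃ i : S, D i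
  have hT : #T ≤ κ := (mk_iUnion_le _).trans <|
    (mul_le_mul' hS.le (ciSup_le' fun i : S ↦ (hD i).le)).trans (mul_eq_self hκ.aleph0_le).le
  obtain ⟨y, hy⟩ := havoid hT (Y := fun i ↦ {y | ¬ IsMeagre ((fun x ↦ (x, y)) ⁻¹' P i)})
    fun i ↦ (hP i).setOf_not_isMeagre_fiber
  obtain ⟨E, hE, hEmem⟩ := hplane (Prod.snd ⁻¹' {y})
    (IsMeagre.preimage_of_isOpenMap continuous_snd isOpenMap_snd (isMeagre_singleton_cantor y))
  have hsec := hadd ((mk_le_mk_of_subset inter_subset_right).trans_lt hE)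
    (Y := fun i : (T ∩ E : Set ι) ↦ (fun x ↦ (x, y)) ⁻¹' P i)
    fun i ↦ not_not.1 (hy ⟨i, i.2.1⟩)
  obtain ⟨R, hR, hSR⟩ := hcov (⋃ i ∈ S, Xs i) <| hmono _ _ (iUnion₂_subset fun i hi x hx ↦ by
    obtain ⟨k, hk⟩ := mem_iUnion.1 (hun ▸ mem_univ (φ (x, y)))
    exact mem_iUnion.2 ⟨⟨k, mem_iUnion.2 ⟨⟨i, hi⟩, hDmem i (x, y) hx k hk⟩,
      hEmem (x, y) rfl k hk⟩, hk⟩) hsec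
  exact (hS ▸ mk_le_mk_of_subset (subset_of_biUnion_subset_biUnion hne hdisj hSR)).not_gt hR

/-- An ideal with `add(I) = cof(I) = κ` is `(κ, κ)`-nicely generated. -/
theorem nicelyGenerated_of_addIdeal_eq_of_cofIdeal_eq {X : Type u} {I : Set (Set X)}
    {κ : Cardinal.{u}} (hκ : κ.IsRegular) (hI : ∀ s t, s ⊆ t → t ∈ I → s ∈ I)
    (hU : ⋃₀ I = Set.univ) (huniv : Set.univ ∉ I) (hadd : addIdeal I = κ) (hcof : cofIdeal I = κ) :
    NicelyGenerated I κ κ := by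
  have hunion : ∀ {J : Type u}, #J < κ → ∀ Y : J → Set X, (∀ j, Y j ∈ I) → (⋃ j, Y j) ∈ I := by
    intro J hJ Y hY
    by_contra hnot
    have : addIdeal I ≤ #(range Y) :=
      addIdeal_le_mk (range_subset_iff.2 hY) (by rwa [sUnion_range])
    exact (hadd ▸ this.trans mk_range_le).not_gt hJ
  obtain ⟨F, hFI, hF, hFc⟩ : cofIdeal I ∈
      {c | ∃ F : Set (Set X), F ⊆ I ∧ (∀ Y ∈ I, ∃ Z ∈ F, Y ⊆ Z) ∧ #F = c} :=
    csInf_mem ⟨_, I, Subset.rfl, fun Y hY ↦ ⟨Y, hY, Subset.rfl⟩, rfl⟩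
  obtain ⟨e⟩ : Nonempty (κ.ord.ToType ≃ F) := Cardinal.eq.1 (by simp [hFc, hcof])
  let Z : κ.ord.ToType → Set X := fun a ↦ e a
  have hZ : ∀ a, Z a ∈ I := fun a ↦ hFI (e a).2
  have hZcof : ∀ Y ∈ I, ∃ a, Y ⊆ Z a := fun Y hY ↦ by
    obtain ⟨W, hW, hYW⟩ := hF Y hY
    exact ⟨e.symm ⟨W, hW⟩, by simpa [Z] using hYW⟩
  let A : κ.ord.ToType → Set X := fun a ↦ Z a \ ⋃ b : Iio a, Z b
  have hAI : ∀ a, A a ∈ I := fun a ↦ hI _ _ sdiff_subset (hZ a)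
  have hAlt : ∀ a b, a < b → Disjoint (A a) (A b) := fun a b hab ↦
    disjoint_left.2 fun x hxa hxb ↦ hxb.2 (mem_iUnion.2 ⟨⟨a, hab⟩, hxa.1⟩)
  have hAdisj : ∀ a b, a ≠ b → Disjoint (A a) (A b) := fun a b hab ↦
    hab.lt_or_gt.elim (hAlt a b) fun hba ↦ (hAlt b a hba).symm
  have hZA : ∀ a, ∀ x ∈ Z a, ∃ b ≤ a, x ∈ A b := by
    intro a
    induction a using WellFoundedLT.induction with
    | ind a ih =>
      intro x hx
      by_cases hxa : x ∈ ⋃ b : Iio a, Z b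
      · obtain ⟨⟨b, hb⟩, hxb⟩ := mem_iUnion.1 hxa
        obtain ⟨c, hc, hxc⟩ := ih b hb x hxb
        exact ⟨c, hc.trans (le_of_lt hb), hxc⟩
      · exact ⟨a, le_rfl, hx, hxa⟩
  let N := {a : κ.ord.ToType | (A a).Nonempty}
  have hNun : (⋃ a : N, A a) = Set.univ := eq_univ_of_forall fun x ↦ by
    obtain ⟨Y, hY, hxY⟩ := mem_sUnion.1 (hU ▸ mem_univ x)
    obtain ⟨a, ha⟩ := hZcof Y hY
    obtain ⟨b, -, hb⟩ := hZA a x (ha hxY)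
    exact mem_iUnion.2 ⟨⟨b, x, hb⟩, hb⟩
  have hN : #N = κ := by
    refine le_antisymm ((mk_set_le N).trans (by simp)) ?_
    by_contra! hlt
    exact huniv (hNun ▸ hunion hlt (fun a : N ↦ A a) fun a ↦ hAI a)
  refine ⟨N, fun a ↦ A a, hN, fun a ↦ hAI a, fun a ↦ a.2, fun a b hab ↦
    hAdisj a b (Subtype.coe_injective.ne hab), hNun, fun D hD ↦ ?_, fun Y hY ↦ ?_⟩
  · rw [biUnion_eq_iUnion]
    exact hunion hD _ fun a ↦ hAI a.1
  · obtain ⟨a, ha⟩ := hZcof Y hY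
    refine ⟨Subtype.val ⁻¹' Iic a, (mk_preimage_of_injective _ _
      Subtype.val_injective).trans_lt (mk_Iic_toType_ord_lt hκ a), fun x hx ↦ ?_⟩
    obtain ⟨b, hb, hxb⟩ := hZA a x (ha hx)
    exact mem_iUnion₂.2 ⟨⟨b, x, hxb⟩, hb, hxb⟩

/-- The number of pieces is at most the number of points. -/
theorem NicelyGenerated.le_mk {X : Type u} {I : Set (Set X)} {κ lam : Cardinal.{u}}
    (h : NicelyGenerated I κ lam) : lam ≤ #X := by
  obtain ⟨ι, Xs, rfl, -, hne, hdisj, -⟩ := h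
  choose x hx using hne
  refine mk_le_of_injective (f := x) fun i j hij ↦ ?_
  by_contra hne
  exact (hdisj i j hne).notMem_of_mem_left (hx i) (hij ▸ hx j)

/-- Corollary 6: for a regular uncountable cardinal `κ`, the meager ideal on the Cantor
space `2^ω` is `(κ, λ)`-nicely generated for some cardinal `λ` with `κ ≤ λ ≤ 2^ℵ₀`
iff `add(M) = cof(M) = κ`. -/
theorem meager_nicelyGenerated_iff (κ : Cardinal.{0})
    (hreg : κ.IsRegular) (hunc : Cardinal.aleph 1 ≤ κ) :
    (∃ lam : Cardinal.{0}, κ ≤ lam ∧ lam ≤ 2 ^ Cardinal.aleph0 ∧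
        NicelyGenerated {s : Set (ℕ → Bool) | IsMeagre s} κ lam) ↔
      (addIdeal {s : Set (ℕ → Bool) | IsMeagre s} = κ ∧
        cofIdeal {s : Set (ℕ → Bool) | IsMeagre s} = κ) := by
  have hmono : ∀ s t : Set (ℕ → Bool), s ⊆ t → t ∈ {s : Set (ℕ → Bool) | IsMeagre s} →
      s ∈ {s : Set (ℕ → Bool) | IsMeagre s} := fun s t hst ht ↦ ht.mono hst
  have hU : ⋃₀ {s : Set (ℕ → Bool) | IsMeagre s} = Set.univ :=
    eq_univ_of_forall fun x ↦ ⟨{x}, isMeagre_singleton_cantor x, rfl⟩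
  constructor
  · rintro ⟨lam, hle, -, h⟩
    obtain rfl : lam = κ := (h.le_of_meager hreg).antisymm hle
    have hadd := h.addIdeal_eq hmono hreg le_rfl
    exact ⟨hadd, (h.cofIdeal_le hreg).antisymm
      (hadd ▸ addIdeal_le_cofIdeal hU not_isMeagre_univ_cantor)⟩
  · rintro ⟨hadd, hcof⟩
    have h := nicelyGenerated_of_addIdeal_eq_of_cofIdeal_eq hreg hmono hU
      not_isMeagre_univ_cantor hadd hcof
    exact ⟨κ, le_rfl, h.le_mk.trans (by simp), h⟩
end
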